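/- With the setup parameters δ = 10⁻¹², sin φ = 10⁻⁴, w₁ = 1/20 and w₂ = 1/1000, let Γ be a segment barrier for the unit square U with total length L ≤ 2 + δ, partitioned into the almost horizontal segments X, the almost vertical segments Y, and the remaining segments Z. Define the thin rectangles U_low = [0,1] × [−w₂, w₁], U_high = [0,1] × [1 − w₁, 1 + w₂], U_left = [−w₂, w₁] × [0,1], and U_right = [1 − w₁, 1 + w₂] × [0,1]. Then Σ_{s ∈ X} H¹(s ∩ U_low) ≥ 0.45, Σ_{s ∈ X} H¹(s ∩ U_high) ≥ 0.45, Σ_{s ∈ Y} H¹(s ∩ U_left) ≥ 0.45, and Σ_{s ∈ Y} H¹(s ∩ U_right) ≥ 0.45. -/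

import Mathlib

open MeasureTheory Set

noncomputable section

/-- A point in the plane. -/
abbrev Pt : Type := EuclideanSpace ℝ (Fin 2)

/-- A line in ℝ² is a set {p + t • v : t ∈ ℝ} for some p, v with v ≠ 0. -/
def IsLine (l : Set Pt) : Prop :=
  ∃ p v : Pt, v ≠ 0 ∧ l = {q : Pt | ∃ t : ℝ, q = p + t • v}

/-- Γ is a barrier (opaque set) for C if every line meeting C also meets Γ. -/
def IsBarrier (Γ C : Set Pt) : Prop :=
  ∀ l : Set Pt, IsLine l → (l ∩ C).Nonempty → (l ∩ Γ).Nonempty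

/-- The closed unit square U = [0,1] × [0,1]. -/
def unitSquare : Set Pt := {p : Pt | p 0 ∈ Icc (0:ℝ) 1 ∧ p 1 ∈ Icc (0:ℝ) 1}

/-- A segment [a, b] is almost horizontal if its direction makes angle at most
φ = arcsin 10⁻⁴ with the x-axis, i.e. |(b − a)₂| ≤ 10⁻⁴ ‖b − a‖. -/
def AlmostHorizontal (a b : Pt) : Prop := |(b - a) 1| ≤ 10 ^ (-4 : ℤ) * ‖b - a‖

/-- A segment [a, b] is almost vertical if its direction makes angle at most
φ = arcsin 10⁻⁴ with the y-axis, i.e. |(b − a)₁| ≤ 10⁻⁴ ‖b − a‖. -/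
def AlmostVertical (a b : Pt) : Prop := |(b - a) 0| ≤ 10 ^ (-4 : ℤ) * ‖b - a‖


lemma wtr_seg (α β : ℝ) (ψ : ℝ → ENNReal) :
    ∫⁻ c in (fun u : ℝ => α + u * β) '' Icc (0:ℝ) 1, ψ c =
      ENNReal.ofReal |β| * ∫⁻ u in Icc (0:ℝ) 1, ψ (α + u * β) := by
  by_cases hβ : β = 0
  · subst hβ
    have : (fun u : ℝ => α + u * 0) '' Icc (0:ℝ) 1 = {α} := by
      ext c; constructor
      · rintro ⟨u, _, rfl⟩; simp
      · rintro rfl; exact ⟨0, by simp⟩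
    rw [this]; simp
  · have hd : ∀ x ∈ Icc (0:ℝ) 1, HasDerivWithinAt (fun u : ℝ => α + u * β) β (Icc 0 1) x := by
      intro x _
      have := (((hasDerivAt_id x).mul_const β).const_add α).hasDerivWithinAt (s := Icc (0:ℝ) 1)
      simpa using this
    have hi : InjOn (fun u : ℝ => α + u * β) (Icc (0:ℝ) 1) := by
      intro x _ y _ h
      have : x * β = y * β := by simpa using h
      exact mul_right_cancel₀ hβ this
    rw [lintegral_image_eq_lintegral_abs_deriv_mul measurableSet_Icc hd hi]
    rw [lintegral_const_mul' _ _ ENNReal.ofReal_ne_top]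

lemma wtr_int {φ : ℝ → ℝ} (hm : Measurable φ) {M : ℝ} (hb : ∀ c, |φ c| ≤ M) (lo hi : ℝ) :
    IntegrableOn φ (Icc lo hi) := by
  refine Measure.integrableOn_of_bounded (M := M) (by simp) hm.aestronglyMeasurable ?_
  exact Filter.Eventually.of_forall (fun c => by simpa using hb c)

lemma wtr_abs_int {φ : ℝ → ℝ} {M : ℝ} (hb : ∀ c, |φ c| ≤ M) :
    |∫ u in Icc (0:ℝ) 1, φ u| ≤ M := by
  have := norm_setIntegral_le_of_norm_le_const (μ := volume) (s := Icc (0:ℝ) 1) (f := φ) (C := M)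
    (by simp) (fun x _ => by simpa using hb x)
  simpa using this

lemma wtr_summ {β J : ℕ → ℝ} (hs : Summable fun i => |β i|) {M : ℝ} (hJ : ∀ i, |J i| ≤ M) :
    Summable fun i => |β i| * J i := by
  refine Summable.of_norm_bounded (hs.mul_right M) (fun i => ?_)
  rw [norm_mul, Real.norm_eq_abs, Real.norm_eq_abs, abs_abs]
  exact mul_le_mul_of_nonneg_left (hJ i) (abs_nonneg _)

lemma wtr_cover0 (α β : ℕ → ℝ) (lo hi : ℝ)
    (hcov : ∀ c ∈ Icc lo hi, ∃ i, ∃ u ∈ Icc (0:ℝ) 1, α i + u * β i = c)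
    (hs : Summable fun i => |β i|) (ψ : ℝ → ℝ) (hm : Measurable ψ) (C : ℝ)
    (h0 : ∀ c, 0 ≤ ψ c) (hC : ∀ c, |ψ c| ≤ C) :
    ∫ c in Icc lo hi, ψ c ≤ ∑' i, |β i| * ∫ u in Icc (0:ℝ) 1, ψ (α i + u * β i) := by
  have hmi : ∀ i, Measurable fun u : ℝ => ψ (α i + u * β i) := fun i => by fun_prop
  have hnn : ∀ i, 0 ≤ |β i| * ∫ u in Icc (0:ℝ) 1, ψ (α i + u * β i) := fun i =>
    mul_nonneg (abs_nonneg _) (integral_nonneg fun u => h0 _)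
  have hsum : Summable fun i => |β i| * ∫ u in Icc (0:ℝ) 1, ψ (α i + u * β i) :=
    wtr_summ hs (M := C) fun i => wtr_abs_int fun u => hC _
  rw [← ENNReal.ofReal_le_ofReal_iff (tsum_nonneg hnn), ENNReal.ofReal_tsum_of_nonneg hnn hsum,
    ofReal_integral_eq_lintegral_ofReal (wtr_int hm hC lo hi)
      (Filter.Eventually.of_forall fun c => h0 c)]
  have hsub : Icc lo hi ⊆ ⋃ i, (fun u : ℝ => α i + u * β i) '' Icc (0:ℝ) 1 := by
    intro c hc
    obtain ⟨i, u, hu, h⟩ := hcov c hc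
    exact mem_iUnion.2 ⟨i, u, hu, h⟩
  calc ∫⁻ c in Icc lo hi, ENNReal.ofReal (ψ c)
      ≤ ∫⁻ c in ⋃ i, (fun u : ℝ => α i + u * β i) '' Icc (0:ℝ) 1, ENNReal.ofReal (ψ c) :=
        lintegral_mono_set hsub
    _ ≤ ∑' i, ∫⁻ c in (fun u : ℝ => α i + u * β i) '' Icc (0:ℝ) 1, ENNReal.ofReal (ψ c) :=
        lintegral_iUnion_le _ _
    _ = _ := by
        congr 1; ext i
        rw [wtr_seg, ENNReal.ofReal_mul (abs_nonneg _), ofReal_integral_eq_lintegral_ofReal]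
        · exact wtr_int (hmi i) (fun u => hC _) 0 1
        · exact Filter.Eventually.of_forall fun c => h0 _

lemma wtr_width (α β : ℕ → ℝ) (lo hi : ℝ)
    (hcov : ∀ c ∈ Icc lo hi, ∃ i, ∃ u ∈ Icc (0:ℝ) 1, α i + u * β i = c)
    (hs : Summable fun i => |β i|) : hi - lo ≤ ∑' i, |β i| := by
  have := wtr_cover0 α β lo hi hcov hs (fun _ => 1) measurable_const 1 (by simp) (by simp)
  simp at this
  linarith

lemma wtr_cover (α β : ℕ → ℝ) (lo hi : ℝ) (hlo : lo ≤ hi)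
    (hcov : ∀ c ∈ Icc lo hi, ∃ i, ∃ u ∈ Icc (0:ℝ) 1, α i + u * β i = c)
    (hs : Summable fun i => |β i|) (ε : ℝ) (hε : ∑' i, |β i| ≤ (hi - lo) * (1 + ε))
    (φ : ℝ → ℝ) (hm : Measurable φ) (M : ℝ) (hM : ∀ c, |φ c| ≤ M) :
    (Summable fun i => |β i| * ∫ u in Icc (0:ℝ) 1, φ (α i + u * β i)) ∧
    (∫ c in Icc lo hi, φ c) - M * ε * (hi - lo) ≤
      ∑' i, |β i| * ∫ u in Icc (0:ℝ) 1, φ (α i + u * β i) := by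
  have hsum : Summable fun i => |β i| * ∫ u in Icc (0:ℝ) 1, φ (α i + u * β i) :=
    wtr_summ hs (M := M) fun i => wtr_abs_int fun u => hM _
  refine ⟨hsum, ?_⟩
  have hM0 : 0 ≤ M := (abs_nonneg _).trans (hM 0)
  have key := wtr_cover0 α β lo hi hcov hs (fun c => φ c + M) (by fun_prop) (2 * M)
    (fun c => by linarith [(abs_le.1 (hM c)).1])
    (fun c => by rw [abs_le]; constructor <;> linarith [(abs_le.1 (hM c)).1, (abs_le.1 (hM c)).2])
  rw [integral_add (wtr_int hm hM lo hi) (by simp)] at key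
  have e : ∀ i, |β i| * ∫ u in Icc (0:ℝ) 1, (φ (α i + u * β i) + M) =
      |β i| * (∫ u in Icc (0:ℝ) 1, φ (α i + u * β i)) + |β i| * M := by
    intro i
    rw [integral_add (wtr_int (φ := fun u => φ (α i + u * β i)) (by fun_prop) (fun u => hM _) 0 1)
      (by simp)]
    simp; ring
  simp_rw [e] at key
  rw [hsum.tsum_add (hs.mul_right M), tsum_mul_right] at key
  simp [hlo] at key
  nlinarith [mul_le_mul_of_nonneg_right hε hM0]

lemma wtr_hausdorff (p q : EuclideanSpace ℝ (Fin 2)) (k : Fin 2)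
    (S : Set (EuclideanSpace ℝ (Fin 2))) (T : Set ℝ)
    (hT : ∀ u ∈ T, u ∈ Icc (0:ℝ) 1 ∧ p + u • (q - p) ∈ S) :
    ENNReal.ofReal (|q k - p k| * volume.real T) ≤ μH[1] (segment ℝ p q ∩ S) := by
  have hTsub : T ⊆ Icc 0 1 := fun u hu => (hT u hu).1
  have hTfin : volume T ≠ ⊤ := ((measure_mono hTsub).trans_lt (by simp)).ne
  have hlip : LipschitzWith 1 (fun v : EuclideanSpace ℝ (Fin 2) => v k) := by
    refine LipschitzWith.of_dist_le_mul fun x y => ?_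
    have := PiLp.norm_apply_le (x - y) k
    simpa [dist_eq_norm] using this
  have h1 := hlip.hausdorffMeasure_image_le (d := 1) zero_le_one (segment ℝ p q ∩ S)
  simp only [ENNReal.coe_one, ENNReal.one_rpow, one_mul] at h1
  rw [hausdorffMeasure_real] at h1
  refine le_trans ?_ h1
  have himg : (fun x => p k + x) '' ((fun u : ℝ => (q k - p k) * u) '' T) ⊆
      (fun v : EuclideanSpace ℝ (Fin 2) => v k) '' (segment ℝ p q ∩ S) := by
    rintro _ ⟨_, ⟨u, hu, rfl⟩, rfl⟩
    refine ⟨p + u • (q - p), ⟨?_, (hT u hu).2⟩, ?_⟩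
    · rw [segment_eq_image']
      exact ⟨u, (hT u hu).1, rfl⟩
    · simp; ring
  refine le_trans ?_ (measure_mono himg)
  rw [ENNReal.ofReal_mul (abs_nonneg _), ofReal_measureReal hTfin]
  rw [image_add_left, measure_preimage_add]
  have h2 := Measure.addHaar_smul (volume : Measure ℝ) (q k - p k) T
  simp only [Module.finrank_self, pow_one] at h2
  rw [← h2]
  rfl

/-- The hinge function. -/
noncomputable def wtrG (c : ℝ) : ℝ := max 0 (1 - 25 * c)

noncomputable def wtrPlus (c : ℝ) : ℝ := if -(1/1000) ≤ c ∧ c ≤ 1 then 500 * wtrG c else -520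
noncomputable def wtrMinus (c : ℝ) : ℝ := if 0 ≤ c ∧ c ≤ 1 + 1/1000 then 500 * wtrG c else -520
noncomputable def wtrH (c : ℝ) : ℝ :=
  if 0 ≤ c ∧ c ≤ 1 then -500 * (wtrG (c - 11/10000) + wtrG (c + 11/10000)) else -1100
noncomputable def wtrPen (lo hi M c : ℝ) : ℝ := if lo ≤ c ∧ c ≤ hi then 0 else -M

lemma wtrG_nonneg (c : ℝ) : 0 ≤ wtrG c := le_max_left _ _
lemma wtrG_ge (c : ℝ) : 1 - 25 * c ≤ wtrG c := le_max_right _ _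
lemma wtrG_le {c B : ℝ} (h0 : 0 ≤ B) (h : 1 - 25 * c ≤ B) : wtrG c ≤ B := max_le h0 h
lemma wtrG_cont : Continuous wtrG := by unfold wtrG; fun_prop
lemma wtrG_zero {c : ℝ} (h : 1/25 ≤ c) : wtrG c = 0 := max_eq_left (by linarith)

lemma wtrPlus_le (c : ℝ) : wtrPlus c ≤ 500 * wtrG c ∧ |wtrPlus c| ≤ 520 ∧ wtrPlus c ≤ 512.5 := by
  have := wtrG_nonneg c
  unfold wtrPlus
  split_ifs with h
  · have h2 : wtrG c ≤ 1.025 := wtrG_le (by norm_num) (by linarith [h.1])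
    refine ⟨le_rfl, ?_, by linarith⟩
    rw [abs_le]; constructor <;> linarith
  · refine ⟨by linarith, by norm_num, by norm_num⟩

lemma wtrMinus_le (c : ℝ) :
    wtrMinus c ≤ 500 * wtrG c ∧ |wtrMinus c| ≤ 520 ∧ wtrMinus c ≤ 500 := by
  have := wtrG_nonneg c
  unfold wtrMinus
  split_ifs with h
  · have h2 : wtrG c ≤ 1 := wtrG_le (by norm_num) (by linarith [h.1])
    refine ⟨le_rfl, ?_, by linarith⟩
    rw [abs_le]; constructor <;> linarith
  · refine ⟨by linarith, by norm_num, by norm_num⟩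

lemma wtrH_le (c : ℝ) : wtrH c ≤ 0 ∧ |wtrH c| ≤ 1100 := by
  have h1 := wtrG_nonneg (c - 11/10000)
  have h2 := wtrG_nonneg (c + 11/10000)
  unfold wtrH
  split_ifs with h
  · have h3 : wtrG (c - 11/10000) ≤ 1.0275 := wtrG_le (by norm_num) (by linarith [h.1])
    have h4 : wtrG (c + 11/10000) ≤ 1 := wtrG_le (by norm_num) (by linarith [h.1])
    refine ⟨by linarith, ?_⟩
    rw [abs_le]; constructor <;> linarith
  · refine ⟨by norm_num, by norm_num⟩

lemma wtrPen_le {M : ℝ} (hM : 0 ≤ M) (lo hi c : ℝ) :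
    wtrPen lo hi M c ≤ 0 ∧ |wtrPen lo hi M c| ≤ M := by
  unfold wtrPen
  split_ifs
  · simpa using hM
  · simpa [abs_of_nonneg hM] using hM

lemma wtrPlus_meas : Measurable wtrPlus :=
  Measurable.ite measurableSet_Icc (wtrG_cont.measurable.const_mul _) measurable_const
lemma wtrMinus_meas : Measurable wtrMinus :=
  Measurable.ite measurableSet_Icc (wtrG_cont.measurable.const_mul _) measurable_const
lemma wtrPen_meas (lo hi M : ℝ) : Measurable (wtrPen lo hi M) :=
  Measurable.ite measurableSet_Icc measurable_const measurable_const
lemma wtrH_meas : Measurable wtrH := by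
  have := wtrG_cont.measurable
  refine Measurable.ite measurableSet_Icc ?_ measurable_const
  fun_prop

lemma wtrG_int {l h : ℝ} (hl : l ≤ 1/25) (hh : 1/25 ≤ h) :
    ∫ c in l..h, wtrG c = (1 - 25 * l) ^ 2 / 50 := by
  rw [← intervalIntegral.integral_add_adjacent_intervals
    (wtrG_cont.intervalIntegrable l (1/25)) (wtrG_cont.intervalIntegrable (1/25) h)]
  have e1 : ∫ c in l..(1/25), wtrG c = ∫ c in l..(1/25), (1 - 25 * c) := by
    apply intervalIntegral.integral_congr
    intro c hc
    rw [uIcc_of_le hl] at hc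
    exact max_eq_right (by linarith [hc.2])
  have e2 : ∫ c in (1/25)..h, wtrG c = ∫ c in (1/25)..h, (0:ℝ) := by
    apply intervalIntegral.integral_congr
    intro c hc
    rw [uIcc_of_le hh] at hc
    exact wtrG_zero hc.1
  rw [e1, e2, intervalIntegral.integral_sub (by simp) (by
    apply Continuous.intervalIntegrable; fun_prop),
    intervalIntegral.integral_const_mul, integral_id]
  simp
  ring

lemma wtr_Icc {l h : ℝ} (hl : l ≤ h) (f : ℝ → ℝ) : ∫ c in Icc l h, f c = ∫ c in l..h, f c := by
  rw [intervalIntegral.integral_of_le hl, integral_Icc_eq_integral_Ioc]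

lemma wtrPlus_int : ∫ c in Icc (-(1/1000) : ℝ) 1, wtrPlus c = 500 * (1.025 ^ 2 / 50) := by
  rw [setIntegral_congr_fun (f := wtrPlus) (g := fun c => 500 * wtrG c) measurableSet_Icc
    (fun c hc => if_pos ⟨hc.1, hc.2⟩), wtr_Icc (by norm_num), intervalIntegral.integral_const_mul,
    wtrG_int (by norm_num) (by norm_num)]
  norm_num

lemma wtrMinus_int : ∫ c in Icc (0 : ℝ) (1 + 1/1000), wtrMinus c = 10 := by
  rw [setIntegral_congr_fun (f := wtrMinus) (g := fun c => 500 * wtrG c) measurableSet_Icc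
    (fun c hc => if_pos ⟨hc.1, hc.2⟩), wtr_Icc (by norm_num), intervalIntegral.integral_const_mul,
    wtrG_int (by norm_num) (by norm_num)]
  norm_num

lemma wtrH_int : ∫ c in Icc (0 : ℝ) 1, wtrH c = -10 * (1.0275 ^ 2 + 0.9725 ^ 2) := by
  have c1 : Continuous fun c : ℝ => wtrG (c - 11/10000) := wtrG_cont.comp (by fun_prop)
  have c2 : Continuous fun c : ℝ => wtrG (c + 11/10000) := wtrG_cont.comp (by fun_prop)
  rw [setIntegral_congr_fun (f := wtrH)
    (g := fun c => -500 * (wtrG (c - 11/10000) + wtrG (c + 11/10000))) measurableSet_Icc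
    (fun c hc => if_pos ⟨hc.1, hc.2⟩), wtr_Icc (by norm_num), intervalIntegral.integral_const_mul,
    intervalIntegral.integral_add (c1.intervalIntegrable _ _) (c2.intervalIntegrable _ _),
    intervalIntegral.integral_comp_sub_right (fun c => wtrG c),
    intervalIntegral.integral_comp_add_right (fun c => wtrG c),
    wtrG_int (by norm_num) (by norm_num), wtrG_int (by norm_num) (by norm_num)]
  norm_num

lemma wtrPen_int (lo hi M : ℝ) : ∫ c in Icc lo hi, wtrPen lo hi M c = 0 := by
  rw [setIntegral_congr_fun (f := wtrPen lo hi M) (g := fun _ => (0:ℝ)) measurableSet_Icc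
    (fun c hc => if_pos ⟨hc.1, hc.2⟩)]
  simp

/-- Pointwise certificate on horizontal pieces. -/
lemma wtr_pointX (x y : ℝ) :
    (wtrPlus (y - x/1000) + wtrMinus (y + x/1000)) / 1000 + wtrPen 0 1 2 x ≤
      if (0 ≤ x ∧ x ≤ 1) ∧ (-(1/1000) ≤ y ∧ y ≤ 1/20) then 1.0125 else 0 := by
  obtain ⟨p1, -, p3⟩ := wtrPlus_le (y - x/1000)
  obtain ⟨m1, -, m3⟩ := wtrMinus_le (y + x/1000)
  by_cases hx : 0 ≤ x ∧ x ≤ 1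
  · have e : wtrPen 0 1 2 x = 0 := if_pos hx
    rw [e]
    by_cases hp : -(1/1000) ≤ y - x/1000 ∧ y - x/1000 ≤ 1
    · by_cases hm : 0 ≤ y + x/1000 ∧ y + x/1000 ≤ 1 + 1/1000
      · by_cases hy : y ≤ 1/20
        · rw [if_pos ⟨hx, by linarith [hp.1, hm.1], hy⟩]
          linarith
        · rw [if_neg (fun h => hy h.2.2)]
          push Not at hy
          rw [wtrG_zero (by linarith [hx.2])] at p1
          rw [wtrG_zero (by linarith [hx.1])] at m1
          linarith
      · have : wtrMinus (y + x/1000) = -520 := if_neg hm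
        rw [this]
        split_ifs <;> linarith
    · have : wtrPlus (y - x/1000) = -520 := if_neg hp
      rw [this]
      split_ifs <;> linarith
  · have e : wtrPen 0 1 2 x = -2 := if_neg hx
    rw [e, if_neg (fun h => hx h.1)]
    linarith

lemma wtrG_convex (y : ℝ) {t w : ℝ} (h : |t| ≤ w) :
    wtrG (y - t) + wtrG (y + t) ≤ wtrG (y - w) + wtrG (y + w) := by
  rw [abs_le] at h
  have a1 := wtrG_nonneg (y - w)
  have a2 := wtrG_nonneg (y + w)
  have b1 := wtrG_ge (y - w)
  have b2 := wtrG_ge (y + w)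
  rcases max_cases 0 (1 - 25 * (y - t)) with h1 | h1 <;>
  rcases max_cases 0 (1 - 25 * (y + t)) with h2 | h2 <;>
  · simp only [wtrG] at *
    rw [h1.1, h2.1]
    linarith [h1.2, h2.2, h.1, h.2]

/-- Pointwise certificate on vertical pieces. -/
lemma wtr_pointY (x y : ℝ) :
    wtrPlus (y - x/1000) + wtrMinus (y + x/1000) + wtrH y + wtrPen (-1) 1 1100 (x - y)
      + wtrPen (-(1/10)) 1 250 (x - y/10) / 10 ≤ 0 := by
  obtain ⟨p1, -, p3⟩ := wtrPlus_le (y - x/1000)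
  obtain ⟨m1, -, m3⟩ := wtrMinus_le (y + x/1000)
  have h1 := (wtrH_le y).1
  have r1 := (wtrPen_le (M := 1100) (by norm_num) (-1) 1 (x - y)).1
  have r2 := (wtrPen_le (M := 250) (by norm_num) (-(1/10)) 1 (x - y/10)).1
  by_cases hy : 0 ≤ y ∧ y ≤ 1
  · have eh : wtrH y = -500 * (wtrG (y - 11/10000) + wtrG (y + 11/10000)) := if_pos hy
    by_cases hr1 : -1 ≤ x - y ∧ x - y ≤ 1
    · by_cases hr2 : -(1/10) ≤ x - y/10 ∧ x - y/10 ≤ 1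
      · have := wtrG_convex y (t := x/1000) (w := 11/10000)
          (abs_le.2 ⟨by linarith [hr2.1, hy.1], by linarith [hr2.2, hy.2]⟩)
        linarith
      · have : wtrPen (-(1/10)) 1 250 (x - y/10) = -250 := if_neg hr2
        have k1 := wtrG_convex y (t := x/1000) (w := 2/1000)
          (abs_le.2 ⟨by linarith [hr1.1, hy.1], by linarith [hr1.2, hy.2]⟩)
        have k2 := wtrG_convex y (t := 0) (w := 11/10000) (by norm_num)
        simp only [sub_zero, add_zero] at k2
        have g0 := wtrG_nonneg y
        have g1 := wtrG_ge y
        have k3 : wtrG (y - 2/1000) ≤ wtrG y + 0.05 := wtrG_le (by linarith) (by linarith)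
        have k4 : wtrG (y + 2/1000) ≤ wtrG y := wtrG_le (by linarith) (by linarith)
        linarith
    · have : wtrPen (-1) 1 1100 (x - y) = -1100 := if_neg hr1
      linarith
  · have : wtrH y = -1100 := if_neg hy
    linarith

lemma wtr_wt {w φ t e M : ℝ} (h : |w - t| ≤ e) (hφ : |φ| ≤ M) : w * φ ≤ t * φ + e * M := by
  have : (w - t) * φ ≤ e * M := by
    refine (le_abs_self _).trans ?_
    rw [abs_mul]
    exact mul_le_mul h hφ (abs_nonneg _) ((abs_nonneg _).trans h)
  linarith

lemma wtr_wt' {w φ t : ℝ} (h : t ≤ w) (hφ : φ ≤ 0) : w * φ ≤ t * φ :=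
  mul_le_mul_of_nonpos_right h hφ

noncomputable def wtrTot (d e x y : ℝ) : ℝ :=
  |e - d/1000| * wtrPlus (y - x/1000) + |e + d/1000| * wtrMinus (y + x/1000) + |e| * wtrH y
  + |d| * wtrPen 0 1 2 x + |d - e| * wtrPen (-1) 1 1100 (x - y)
  + |d - e/10| * wtrPen (-(1/10)) 1 250 (x - y/10)

lemma wtr_point (d e x y : ℝ) : wtrTot d e x y ≤
    (if |e| ≤ |d| then |d| else 0) *
      (if (0 ≤ x ∧ x ≤ 1) ∧ (-(1/1000) ≤ y ∧ y ≤ 1/20) then 1.0125 else 0)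
      + 1360 * min |d| |e| := by
  unfold wtrTot
  obtain ⟨-, p2, -⟩ := wtrPlus_le (y - x/1000)
  obtain ⟨-, m2, -⟩ := wtrMinus_le (y + x/1000)
  have h1 := (wtrH_le y).1
  have v1 := (wtrPen_le (M := 2) (by norm_num) 0 1 x).1
  obtain ⟨r1, r1'⟩ := wtrPen_le (M := 1100) (by norm_num) (-1) 1 (x - y)
  obtain ⟨r2, r2'⟩ := wtrPen_le (M := 250) (by norm_num) (-(1/10)) 1 (x - y/10)
  have hd := abs_nonneg d
  have he := abs_nonneg e
  have hd1 : |d/1000| = |d|/1000 := by rw [abs_div]; norm_num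
  have he1 : |e/10| = |e|/10 := by rw [abs_div]; norm_num
  have hA1 := abs_sub_abs_le_abs_sub e (d/1000)
  have hA2 := abs_sub e (d/1000)
  have hA3 := abs_sub_abs_le_abs_sub (d/1000) e
  rw [abs_sub_comm (d/1000) e] at hA3
  have hB1 := abs_sub_abs_le_abs_sub e (-(d/1000))
  have hB2 := abs_add_le e (d/1000)
  have hB3 := abs_sub_abs_le_abs_sub (-(d/1000)) e
  rw [abs_sub_comm (-(d/1000)) e] at hB3
  rw [sub_neg_eq_add, abs_neg] at hB1 hB3
  rw [hd1] at *
  split_ifs with hc hL hL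
  all_goals try
    have hX := wtr_pointX x y
    rw [min_eq_right hc]
    have a1 := wtr_wt (w := |e - d/1000|) (t := |d|/1000) (e := |e|)
      (abs_le.2 ⟨by linarith, by linarith⟩) p2
    have a2 := wtr_wt (w := |e + d/1000|) (t := |d|/1000) (e := |e|)
      (abs_le.2 ⟨by linarith, by linarith⟩) m2
    have a3 := mul_nonpos_of_nonneg_of_nonpos he h1
    have a4 := mul_nonpos_of_nonneg_of_nonpos (abs_nonneg (d - e)) r1
    have a5 := mul_nonpos_of_nonneg_of_nonpos (abs_nonneg (d - e/10)) r2
    first | rw [if_pos hL] at hX | rw [if_neg hL] at hX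
    have := mul_le_mul_of_nonneg_left hX hd
    nlinarith
  all_goals
    have hY := wtr_pointY x y
    push Not at hc
    rw [min_eq_left hc.le]
    have a1 := wtr_wt (w := |e - d/1000|) (t := |e|) (e := |d|/1000)
      (abs_le.2 ⟨by linarith, by linarith⟩) p2
    have a2 := wtr_wt (w := |e + d/1000|) (t := |e|) (e := |d|/1000)
      (abs_le.2 ⟨by linarith, by linarith⟩) m2
    have a3 := mul_nonpos_of_nonneg_of_nonpos hd v1
    have b4 := abs_sub_abs_le_abs_sub e d
    rw [abs_sub_comm e d] at b4
    have b5 := abs_sub_abs_le_abs_sub (e/10) d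
    rw [abs_sub_comm (e/10) d, he1] at b5
    have a4 := wtr_wt' b4 r1
    have a5 := wtr_wt' b5 r2
    have c4 := mul_le_mul_of_nonneg_left (abs_le.1 r1').1 hd
    have c5 := mul_le_mul_of_nonneg_left (abs_le.1 r2').1 hd
    have := mul_le_mul_of_nonneg_left hY he
    nlinarith

set_option maxHeartbeats 4000000 in
lemma wtr_core (A0 D0 A1 D1 l : ℕ → ℝ)
    (hbar : ∀ p q x y : ℝ, (p ≠ 0 ∨ q ≠ 0) → x ∈ Icc (0:ℝ) 1 → y ∈ Icc (0:ℝ) 1 →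
      ∃ i, ∃ u ∈ Icc (0:ℝ) 1,
        p * (A0 i + u * D0 i) + q * (A1 i + u * D1 i) = p * x + q * y)
    (hl0 : ∀ i, 0 ≤ l i) (hl : ∀ i, l i ^ 2 = D0 i ^ 2 + D1 i ^ 2)
    (hsum : Summable l) (hL : ∑' i, l i ≤ 2 + 10 ^ (-12 : ℤ))
    (T : ℕ → Set ℝ)
    (hT : ∀ i, T i = {u | u ∈ Icc (0:ℝ) 1 ∧ (0 ≤ A0 i + u * D0 i ∧ A0 i + u * D0 i ≤ 1) ∧
      (-(1/1000) ≤ A1 i + u * D1 i ∧ A1 i + u * D1 i ≤ 1/20)})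
    (P : ℕ → Prop) [DecidablePred P] (hP : ∀ i, P i ↔ |D1 i| ≤ 10 ^ (-4 : ℤ) * l i) :
    (Summable fun i => if P i then |D0 i| * volume.real (T i) else 0) ∧
    0.45 ≤ ∑' i, if P i then |D0 i| * volume.real (T i) else 0 := by
  -- basic size bounds
  have hx : ∀ i, |D0 i| ≤ l i := fun i =>
    abs_le_of_sq_le_sq (by nlinarith [hl i, sq_nonneg (D1 i)]) (hl0 i)
  have hy : ∀ i, |D1 i| ≤ l i := fun i =>
    abs_le_of_sq_le_sq (by nlinarith [hl i, sq_nonneg (D0 i)]) (hl0 i)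
  have sx : Summable fun i => |D0 i| := hsum.of_nonneg_of_le (fun i => abs_nonneg _) hx
  have sy : Summable fun i => |D1 i| := hsum.of_nonneg_of_le (fun i => abs_nonneg _) hy
  have smin : Summable fun i => min |D0 i| |D1 i| :=
    sx.of_nonneg_of_le (fun i => le_min (abs_nonneg _) (abs_nonneg _)) (fun i => min_le_left _ _)
  have smax : Summable fun i => max |D0 i| |D1 i| :=
    hsum.of_nonneg_of_le (fun i => le_max_of_le_left (abs_nonneg _)) (fun i => max_le (hx i) (hy i))
  have spq : ∀ p q : ℝ, Summable fun i => |p * D0 i + q * D1 i| := fun p q =>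
    ((sx.mul_left |p|).add (sy.mul_left |q|)).of_nonneg_of_le (fun i => abs_nonneg _)
      (fun i => by
        rw [← abs_mul, ← abs_mul]
        exact abs_add_le _ _)
  have hcov : ∀ p q lo hi x0 y0 x1 y1 : ℝ, (p ≠ 0 ∨ q ≠ 0) → lo < hi →
      x0 ∈ Icc (0:ℝ) 1 → y0 ∈ Icc (0:ℝ) 1 → x1 ∈ Icc (0:ℝ) 1 → y1 ∈ Icc (0:ℝ) 1 →
      p * x0 + q * y0 = lo → p * x1 + q * y1 = hi →
      ∀ c ∈ Icc lo hi, ∃ i, ∃ u ∈ Icc (0:ℝ) 1,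
        (p * A0 i + q * A1 i) + u * (p * D0 i + q * D1 i) = c := by
    intro p q lo hi x0 y0 x1 y1 hpq hlh hx0 hy0 hx1 hy1 e0 e1 c hc
    have hpos : 0 < hi - lo := by linarith
    set t := (c - lo) / (hi - lo) with ht
    have ht0 : 0 ≤ t := div_nonneg (by linarith [hc.1]) hpos.le
    have ht1 : t ≤ 1 := (div_le_one hpos).2 (by linarith [hc.2])
    have htc : t * (hi - lo) = c - lo := div_mul_cancel₀ _ hpos.ne'
    obtain ⟨i, u, hu, h⟩ := hbar p q ((1 - t) * x0 + t * x1) ((1 - t) * y0 + t * y1) hpq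
      (convex_Icc (0:ℝ) 1 hx0 hx1 (by linarith) ht0 (by ring))
      (convex_Icc (0:ℝ) 1 hy0 hy1 (by linarith) ht0 (by ring))
    refine ⟨i, u, hu, ?_⟩
    have : p * ((1 - t) * x0 + t * x1) + q * ((1 - t) * y0 + t * y1) = c := by
      have : p * ((1 - t) * x0 + t * x1) + q * ((1 - t) * y0 + t * y1) =
        (p * x0 + q * y0) + t * ((p * x1 + q * y1) - (p * x0 + q * y0)) := by ring
      rw [this, e0, e1]; linarith
    rw [← this, ← h]; ring
  have i0 : (0:ℝ) ∈ Icc (0:ℝ) 1 := by simp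
  have i1 : (1:ℝ) ∈ Icc (0:ℝ) 1 := by simp
  -- widths
  have wx : 1 ≤ ∑' i, |D0 i| := by
    have := wtr_width _ _ 0 1 (hcov 1 0 0 1 0 0 1 0 (by simp) (by simp) i0 i0 i1 i0
      (by simp) (by simp)) (spq 1 0)
    simpa using this
  have wy : 1 ≤ ∑' i, |D1 i| := by
    have := wtr_width _ _ 0 1 (hcov 0 1 0 1 0 0 0 1 (by simp) (by simp) i0 i0 i0 i1
      (by simp) (by simp)) (spq 0 1)
    simpa using this
  have wmax : 2 ≤ ∑' i, max |D0 i| |D1 i| := by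
    have h1 := wtr_width _ _ 0 2 (hcov 1 1 0 2 0 0 1 1 (by simp) (by simp) i0 i0 i1 i1
      (by simp) (by norm_num)) (spq 1 1)
    have h2 := wtr_width _ _ (-1) 1 (hcov 1 (-1) (-1) 1 0 1 1 0 (by simp) (by simp) i0 i1 i1 i0
      (by simp) (by norm_num)) (spq 1 (-1))
    have h3 := ((spq 1 1).add (spq 1 (-1))).tsum_le_tsum (g := fun i => 2 * max |D0 i| |D1 i|)
      (fun i => by
        rcases abs_cases (1 * D0 i + 1 * D1 i) with h | h <;>
        rcases abs_cases (1 * D0 i + -1 * D1 i) with h' | h' <;>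
        linarith [le_max_left |D0 i| |D1 i|, le_max_right |D0 i| |D1 i|, le_abs_self (D0 i),
          le_abs_self (D1 i), neg_abs_le (D0 i), neg_abs_le (D1 i)])
      (smax.mul_left 2)
    rw [(spq 1 1).tsum_add (spq 1 (-1)), tsum_mul_left] at h3
    linarith
  have hd : (10 : ℝ) ^ (-12 : ℤ) = 1 / 10 ^ 12 := by norm_num
  have hd4 : (10 : ℝ) ^ (-4 : ℤ) = 1 / 10 ^ 4 := by norm_num
  rw [hd] at hL
  have sdef : Summable fun i => l i - max |D0 i| |D1 i| := hsum.sub smax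
  have hdef : ∑' i, (l i - max |D0 i| |D1 i|) ≤ 1 / 10 ^ 12 := by
    rw [hsum.tsum_sub smax]; linarith
  have hdef0 : ∀ i, 0 ≤ l i - max |D0 i| |D1 i| := fun i => by
    linarith [max_le (hx i) (hy i)]
  have hmm : ∀ i, l i ^ 2 = max |D0 i| |D1 i| ^ 2 + min |D0 i| |D1 i| ^ 2 := by
    intro i
    rw [hl i]
    rcases le_total |D0 i| |D1 i| with h | h
    · rw [max_eq_right h, min_eq_left h, sq_abs, sq_abs]; ring
    · rw [max_eq_left h, min_eq_right h, sq_abs, sq_abs]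
  have hmin : ∑' i, min |D0 i| |D1 i| ≤ 2.05 / 10 ^ 6 := by
    have h3 := smin.tsum_le_tsum
      (g := fun i => (1 / 10 ^ 6 / 2) * l i + 10 ^ 6 * (l i - max |D0 i| |D1 i|))
      (fun i => by
        have h0 : 0 ≤ min |D0 i| |D1 i| := le_min (abs_nonneg _) (abs_nonneg _)
        have hM0 : 0 ≤ max |D0 i| |D1 i| := le_max_of_le_left (abs_nonneg _)
        have h1 := hdef0 i
        have h2 := hmm i
        set m := min |D0 i| |D1 i|
        set k := max |D0 i| |D1 i|
        refine abs_le_of_sq_le_sq' ?_ ?_ |>.2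
        · have : m ^ 2 ≤ 2 * l i * (l i - k) := by nlinarith
          nlinarith [sq_nonneg ((1 / 10 ^ 6 / 2) * l i - 10 ^ 6 * (l i - k))]
        · have := hl0 i
          positivity)
      ((hsum.mul_left _).add (sdef.mul_left _))
    rw [(hsum.mul_left _).tsum_add (sdef.mul_left _), tsum_mul_left, tsum_mul_left] at h3
    linarith
  -- upper bounds on the total coordinate lengths
  have hmxmn : (∑' i, max |D0 i| |D1 i|) + ∑' i, min |D0 i| |D1 i| =
      (∑' i, |D0 i|) + ∑' i, |D1 i| := by
    rw [← smax.tsum_add smin, ← sx.tsum_add sy]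
    congr 1; ext i; exact max_add_min _ _
  have hmaxle : ∑' i, max |D0 i| |D1 i| ≤ 2 + 1 / 10 ^ 12 :=
    (smax.tsum_le_tsum (fun i => max_le (hx i) (hy i)) hsum).trans hL
  have ux : ∑' i, |D0 i| ≤ 1 + 2.1 / 10 ^ 6 := by linarith
  have uy : ∑' i, |D1 i| ≤ 1 + 2.1 / 10 ^ 6 := by linarith
  have upq : ∀ p q : ℝ, ∑' i, |p * D0 i + q * D1 i| ≤ (|p| + |q|) * (1 + 2.1 / 10 ^ 6) := by
    intro p q
    have h3 := (spq p q).tsum_le_tsum (g := fun i => |p| * |D0 i| + |q| * |D1 i|)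
      (fun i => by
        rw [← abs_mul, ← abs_mul]
        exact abs_add_le _ _)
      ((sx.mul_left |p|).add (sy.mul_left |q|))
    rw [(sx.mul_left |p|).tsum_add (sy.mul_left |q|), tsum_mul_left, tsum_mul_left] at h3
    linarith [mul_le_mul_of_nonneg_left ux (abs_nonneg p),
      mul_le_mul_of_nonneg_left uy (abs_nonneg q)]
  have dir : ∀ p q lo hi x0 y0 x1 y1 : ℝ, (p ≠ 0 ∨ q ≠ 0) → lo < hi → hi - lo = |p| + |q| →
      x0 ∈ Icc (0:ℝ) 1 → y0 ∈ Icc (0:ℝ) 1 → x1 ∈ Icc (0:ℝ) 1 → y1 ∈ Icc (0:ℝ) 1 →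
      p * x0 + q * y0 = lo → p * x1 + q * y1 = hi → ∀ (φ : ℝ → ℝ) (M : ℝ), Measurable φ →
      (∀ c, |φ c| ≤ M) →
      (Summable fun i => |p * D0 i + q * D1 i| * ∫ u in Icc (0:ℝ) 1,
        φ ((p * A0 i + q * A1 i) + u * (p * D0 i + q * D1 i))) ∧
      (∫ c in Icc lo hi, φ c) - M * (2.1 / 10 ^ 6) * (hi - lo) ≤
        ∑' i, |p * D0 i + q * D1 i| * ∫ u in Icc (0:ℝ) 1,
        φ ((p * A0 i + q * A1 i) + u * (p * D0 i + q * D1 i)) := by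
    intro p q lo hi x0 y0 x1 y1 hpq hlh hw hx0 hy0 hx1 hy1 e0 e1 φ M hm hM
    exact wtr_cover _ _ lo hi hlh.le (hcov p q lo hi x0 y0 x1 y1 hpq hlh hx0 hy0 hx1 hy1 e0 e1)
      (spq p q) _ (by rw [hw]; exact upq p q) φ hm M hM
  obtain ⟨s1, k1⟩ := dir (-(1/1000)) 1 (-(1/1000)) 1 1 0 0 1 (by simp) (by norm_num)
    (by norm_num [abs_of_pos]) i1 i0 i0 i1 (by norm_num) (by norm_num) wtrPlus 520 wtrPlus_meas
    (fun c => (wtrPlus_le c).2.1)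
  obtain ⟨s2, k2⟩ := dir (1/1000) 1 0 (1 + 1/1000) 0 0 1 1 (by simp) (by norm_num)
    (by norm_num [abs_of_pos]) i0 i0 i1 i1 (by norm_num) (by norm_num) wtrMinus 520 wtrMinus_meas
    (fun c => (wtrMinus_le c).2.1)
  obtain ⟨s3, k3⟩ := dir 0 1 0 1 0 0 0 1 (by simp) (by norm_num)
    (by norm_num) i0 i0 i0 i1 (by norm_num) (by norm_num) wtrH 1100 wtrH_meas
    (fun c => (wtrH_le c).2)
  obtain ⟨s4, k4⟩ := dir 1 0 0 1 0 0 1 0 (by simp) (by norm_num)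
    (by norm_num) i0 i0 i1 i0 (by norm_num) (by norm_num) (wtrPen 0 1 2) 2 (wtrPen_meas _ _ _)
    (fun c => (wtrPen_le (by norm_num) _ _ c).2)
  obtain ⟨s5, k5⟩ := dir 1 (-1) (-1) 1 0 1 1 0 (by simp) (by norm_num)
    (by norm_num) i0 i1 i1 i0 (by norm_num) (by norm_num) (wtrPen (-1) 1 1100) 1100
    (wtrPen_meas _ _ _) (fun c => (wtrPen_le (by norm_num) _ _ c).2)
  obtain ⟨s6, k6⟩ := dir 1 (-(1/10)) (-(1/10)) 1 0 1 1 0 (by simp) (by norm_num)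
    (by norm_num [abs_of_pos]) i0 i1 i1 i0 (by norm_num) (by norm_num) (wtrPen (-(1/10)) 1 250) 250
    (wtrPen_meas _ _ _) (fun c => (wtrPen_le (by norm_num) _ _ c).2)
  rw [wtrPlus_int] at k1
  rw [wtrMinus_int] at k2
  rw [wtrH_int] at k3
  rw [wtrPen_int] at k4 k5 k6
  have sall := ((((s1.add s2).add s3).add s4).add s5).add s6
  have etot := ((((s1.add s2).add s3).add s4).add s5).tsum_add s6
  rw [(((s1.add s2).add s3).add s4).tsum_add s5, ((s1.add s2).add s3).tsum_add s4,
    (s1.add s2).tsum_add s3, s1.tsum_add s2] at etot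
  -- measure of the low part
  have hTm : ∀ i, MeasurableSet (T i) := by
    intro i
    rw [hT i]
    have c0 : Measurable fun u : ℝ => A0 i + u * D0 i := by fun_prop
    have c1 : Measurable fun u : ℝ => A1 i + u * D1 i := by fun_prop
    exact measurableSet_Icc.inter ((c0 measurableSet_Icc).inter (c1 measurableSet_Icc))
  have hTs : ∀ i, T i ⊆ Icc 0 1 := fun i u hu => by rw [hT i] at hu; exact hu.1
  have hm0 : ∀ i, 0 ≤ volume.real (T i) := fun i => measureReal_nonneg
  have hm1 : ∀ i, volume.real (T i) ≤ 1 := fun i => by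
    have := measureReal_mono (μ := volume) (hTs i) (by simp)
    simpa using this
  have sR : Summable fun i => (if |D1 i| ≤ |D0 i| then |D0 i| else 0) * volume.real (T i) := by
    refine sx.of_nonneg_of_le (fun i => ?_) (fun i => ?_)
    · split_ifs
      · exact mul_nonneg (abs_nonneg _) (hm0 i)
      · simp
    · split_ifs
      · exact mul_le_of_le_one_right (abs_nonneg _) (hm1 i)
      · simp
  have sR' : Summable fun i =>
      (if |D1 i| ≤ |D0 i| then |D0 i| else 0) * (1.0125 * volume.real (T i)) :=
    (sR.mul_left 1.0125).congr (fun i => by ring)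
  have htot := sall.tsum_le_tsum
    (g := fun i => (if |D1 i| ≤ |D0 i| then |D0 i| else 0) * (1.0125 * volume.real (T i))
      + 1360 * min |D0 i| |D1 i|) (fun i => by
    beta_reduce
    have hI : ∀ p q : ℝ, ∀ φ : ℝ → ℝ, Measurable φ → ∀ M, (∀ c, |φ c| ≤ M) →
        Integrable (fun u => |p * D0 i + q * D1 i| *
          φ ((p * A0 i + q * A1 i) + u * (p * D0 i + q * D1 i))) (volume.restrict (Icc (0:ℝ) 1)) :=
      fun p q φ hφ M hM => (wtr_int (φ := fun u => φ ((p * A0 i + q * A1 i) +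
        u * (p * D0 i + q * D1 i))) (by fun_prop) (fun u => hM _) 0 1).const_mul _
    have t1 := hI (-(1/1000)) 1 wtrPlus wtrPlus_meas 520 (fun c => (wtrPlus_le c).2.1)
    have t2 := hI (1/1000) 1 wtrMinus wtrMinus_meas 520 (fun c => (wtrMinus_le c).2.1)
    have t3 := hI 0 1 wtrH wtrH_meas 1100 (fun c => (wtrH_le c).2)
    have t4 := hI 1 0 (wtrPen 0 1 2) (wtrPen_meas _ _ _) 2
      (fun c => (wtrPen_le (by norm_num) _ _ c).2)
    have t5 := hI 1 (-1) (wtrPen (-1) 1 1100) (wtrPen_meas _ _ _) 1100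
      (fun c => (wtrPen_le (by norm_num) _ _ c).2)
    have t6 := hI 1 (-(1/10)) (wtrPen (-(1/10)) 1 250) (wtrPen_meas _ _ _) 250
      (fun c => (wtrPen_le (by norm_num) _ _ c).2)
    have ei := integral_add ((((t1.add t2).add t3).add t4).add t5) t6
    rw [integral_add' (((t1.add t2).add t3).add t4) t5, integral_add' ((t1.add t2).add t3) t4,
      integral_add' (t1.add t2) t3, integral_add' t1 t2] at ei
    simp only [integral_const_mul] at ei
    have hind : ∫ u in Icc (0:ℝ) 1, (T i).indicator (fun _ => (1.0125:ℝ)) u =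
        1.0125 * volume.real (T i) := by
      rw [integral_indicator (hTm i), Measure.restrict_restrict (hTm i),
        inter_eq_left.2 (hTs i)]
      simp [mul_comm]
    have hindI : Integrable ((T i).indicator (fun _ => (1.0125:ℝ)))
        (volume.restrict (Icc (0:ℝ) 1)) :=
      (integrable_const _).indicator (hTm i)
    refine ei.symm.le.trans (le_trans (setIntegral_mono_on ((((((t1.add t2).add t3).add t4).add
      t5).add t6)) (g := fun u => (if |D1 i| ≤ |D0 i| then |D0 i| else 0) *
        (T i).indicator (fun _ => (1.0125:ℝ)) u + 1360 * min |D0 i| |D1 i|)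
        ((hindI.const_mul _).add (integrable_const _)) measurableSet_Icc ?_) ?_)
    · intro u hu
      have hp := wtr_point (D0 i) (D1 i) (A0 i + u * D0 i) (A1 i + u * D1 i)
      have hii : (T i).indicator (fun _ => (1.0125:ℝ)) u =
          if (0 ≤ A0 i + u * D0 i ∧ A0 i + u * D0 i ≤ 1) ∧
            (-(1/1000) ≤ A1 i + u * D1 i ∧ A1 i + u * D1 i ≤ 1/20) then 1.0125 else 0 := by
        have hiff : u ∈ T i ↔ (0 ≤ A0 i + u * D0 i ∧ A0 i + u * D0 i ≤ 1) ∧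
            (-(1/1000) ≤ A1 i + u * D1 i ∧ A1 i + u * D1 i ≤ 1/20) := by
          rw [hT i]
          simp only [mem_setOf_eq, hu, true_and]
        split_ifs with hin
        · rw [indicator_of_mem (hiff.2 hin)]
        · rw [indicator_of_notMem (fun hh => hin (hiff.1 hh))]
      rw [hii]
      refine le_trans (le_of_eq ?_) hp
      unfold wtrTot
      simp only [Pi.add_apply]
      congr 1
      · congr 1
        · congr 1
          · congr 1
            · congr 1
              · congr 2 <;> ring
              · congr 2 <;> ring
            · congr 2 <;> ring
          · congr 2 <;> ring
        · congr 2 <;> ring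
      · congr 2 <;> ring
    · rw [integral_add (hindI.const_mul _) (integrable_const _), integral_const_mul, hind]
      simp)
    (sR'.add (smin.mul_left 1360))
  rw [etot, sR'.tsum_add (smin.mul_left 1360), tsum_mul_left] at htot
  have eR : ∑' i, (if |D1 i| ≤ |D0 i| then |D0 i| else 0) * (1.0125 * volume.real (T i)) =
      1.0125 * ∑' i, (if |D1 i| ≤ |D0 i| then |D0 i| else 0) * volume.real (T i) := by
    rw [← tsum_mul_left]; congr 1; ext i; ring
  rw [eR] at htot
  have hR : 0.46 ≤ ∑' i, (if |D1 i| ≤ |D0 i| then |D0 i| else 0) * volume.real (T i) := by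
    norm_num at k1 k2 k3 k4 k5 k6 htot hmin ⊢
    linarith
  have sP : Summable fun i => if P i then |D0 i| * volume.real (T i) else 0 := by
    refine sx.of_nonneg_of_le (fun i => ?_) (fun i => ?_)
    · split_ifs
      · exact mul_nonneg (abs_nonneg _) (hm0 i)
      · simp
    · split_ifs
      · exact mul_le_of_le_one_right (abs_nonneg _) (hm1 i)
      · simp
  refine ⟨sP, ?_⟩
  have hfin := sR.tsum_le_tsum
    (g := fun i => (if P i then |D0 i| * volume.real (T i) else 0) +
      (2 * 10 ^ 8) * (l i - max |D0 i| |D1 i|)) (fun i => by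
      have h0 := hdef0 i
      by_cases hp : P i
      · rw [if_pos hp]
        split_ifs
        · linarith
        · have := mul_nonneg (abs_nonneg (D0 i)) (hm0 i)
          linarith
      · rw [if_neg hp]
        split_ifs with h
        · rw [hP i, hd4] at hp
          push Not at hp
          have h1 := hmm i
          rw [max_eq_left h] at h1 ⊢
          rw [min_eq_right h] at h1
          have h2 := mul_le_of_le_one_right (abs_nonneg (D0 i)) (hm1 i)
          have hlp := hl0 i
          have h3 := hx i
          have h4 : (1 / 10 ^ 4 * l i) ^ 2 ≤ |D1 i| ^ 2 :=
            pow_le_pow_left₀ (by positivity) hp.le 2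
          rcases hlp.eq_or_lt with hz | hz
          · rw [← hz] at h3 ⊢
            have := abs_nonneg (D0 i)
            nlinarith
          · have h5 : 1 / 10 ^ 8 * l i ≤ 2 * (l i - |D0 i|) := by
              by_contra hcon
              push Not at hcon
              have h6 := mul_lt_mul_of_pos_right hcon hz
              have h7 := mul_le_mul_of_nonneg_left h3 (sub_nonneg.2 h3)
              nlinarith only [h6, h7, h4, h1]
            linarith
        · linarith)
    (sP.add (sdef.mul_left _))
  rw [sP.tsum_add (sdef.mul_left _), tsum_mul_left] at hfin
  linarith

lemma wtr_final (a b : ℕ → Pt)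
    (hbar : IsBarrier (⋃ i, segment ℝ (a i) (b i)) unitSquare)
    (hsum : Summable fun i => ‖b i - a i‖)
    (hL : ∑' i, ‖b i - a i‖ ≤ 2 + 10 ^ (-12 : ℤ))
    (k k' : Fin 2) (hk : (k = 0 ∧ k' = 1) ∨ (k = 1 ∧ k' = 0))
    (σ τ : ℝ) (hτ : (σ = 0 ∧ τ = 1) ∨ (σ = 1 ∧ τ = -1)) (S : Set Pt)
    (hS : ∀ p, p ∈ S ↔ p k ∈ Icc (0:ℝ) 1 ∧ σ + τ * p k' ∈ Icc (-(1/1000) : ℝ) (1/20))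
    (Pr : ℕ → Prop) (hP : ∀ i, Pr i ↔ |(b i - a i) k'| ≤ 10 ^ (-4 : ℤ) * ‖b i - a i‖) :
    ENNReal.ofReal 0.45 ≤ ∑' i : {j : ℕ // Pr j}, μH[1] (segment ℝ (a i.1) (b i.1) ∩ S) := by
  classical
  have hτ2 : τ * τ = 1 := by rcases hτ with ⟨_, h⟩ | ⟨_, h⟩ <;> rw [h] <;> norm_num
  have hτa : |τ| = 1 := by rcases hτ with ⟨_, h⟩ | ⟨_, h⟩ <;> rw [h] <;> norm_num
  have hkk : k' ≠ k := by rcases hk with ⟨rfl, rfl⟩ | ⟨rfl, rfl⟩ <;> decide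
  obtain ⟨hs, hmain⟩ := wtr_core (fun i => a i k) (fun i => (b i - a i) k)
    (fun i => σ + τ * a i k') (fun i => τ * (b i - a i) k') (fun i => ‖b i - a i‖)
    (by
      intro p q x y hpq hx hy
      set v : Pt := WithLp.toLp 2 (fun j => if j = k then x else τ * (y - σ)) with hv
      set w : Pt := WithLp.toLp 2 (fun j => if j = k then -(q * τ) else p) with hw
      have vk : v k = x := by simp [hv]
      have vk' : v k' = τ * (y - σ) := by simp [hv, hkk]
      have wk : w k = -(q * τ) := by simp [hw]
      have wk' : w k' = p := by simp [hw, hkk]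
      have hw0 : w ≠ 0 := by
        intro h0
        have h1 : w k = 0 := by rw [h0]; rfl
        have h2 : w k' = 0 := by rw [h0]; rfl
        rw [wk] at h1
        rw [wk'] at h2
        have hq : q = 0 := by
          have : q * τ * τ = 0 := by rw [neg_eq_zero.1 h1, zero_mul]
          rwa [mul_assoc, hτ2, mul_one] at this
        rcases hpq with h | h
        · exact h h2
        · exact h hq
      have hvU : v ∈ unitSquare := by
        have hy' : v k' ∈ Icc (0:ℝ) 1 := by
          rw [vk']
          rcases hτ with ⟨rfl, rfl⟩ | ⟨rfl, rfl⟩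
          · simpa using hy
          · constructor <;> linarith [hy.1, hy.2]
        rw [← vk] at hx
        rcases hk with ⟨rfl, rfl⟩ | ⟨rfl, rfl⟩
        · exact ⟨hx, hy'⟩
        · exact ⟨hy', hx⟩
      obtain ⟨z, ⟨t, rfl⟩, hz2⟩ := hbar {r | ∃ t : ℝ, r = v + t • w} ⟨v, w, hw0, rfl⟩
        ⟨v, ⟨0, by simp⟩, hvU⟩
      obtain ⟨i, hi⟩ := mem_iUnion.1 hz2
      rw [segment_eq_image'] at hi
      obtain ⟨u, hu, h⟩ := hi
      refine ⟨i, u, hu, ?_⟩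
      have e1 : a i k + u * (b i - a i) k = x + t * (-(q * τ)) := by
        have := congrArg (fun r : Pt => r k) h
        rw [← vk, ← wk]
        simpa using this
      have e2 : a i k' + u * (b i - a i) k' = τ * (y - σ) + t * p := by
        have := congrArg (fun r : Pt => r k') h
        rw [← vk', ← wk']
        simpa using this
      beta_reduce
      linear_combination p * e1 + q * τ * e2 + q * (y - σ) * hτ2)
    (fun i => norm_nonneg _)
    (by
      intro i
      beta_reduce
      rw [EuclideanSpace.real_norm_sq_eq, Fin.sum_univ_two, mul_pow]
      have : τ ^ 2 = 1 := by rw [sq, hτ2]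
      rw [this]
      rcases hk with ⟨rfl, rfl⟩ | ⟨rfl, rfl⟩ <;> ring)
    hsum hL _ (fun i => rfl) Pr
    (by
      intro i
      beta_reduce
      rw [hP i, abs_mul, hτa, one_mul])
  have hTi : ∀ i, ENNReal.ofReal (|(b i - a i) k| * volume.real
      {u | u ∈ Icc (0:ℝ) 1 ∧ (0 ≤ a i k + u * (b i - a i) k ∧ a i k + u * (b i - a i) k ≤ 1) ∧
      (-(1/1000) ≤ σ + τ * a i k' + u * (τ * (b i - a i) k') ∧
        σ + τ * a i k' + u * (τ * (b i - a i) k') ≤ 1/20)}) ≤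
      μH[1] (segment ℝ (a i) (b i) ∩ S) := by
    intro i
    refine wtr_hausdorff (a i) (b i) k S _ ?_
    rintro u ⟨hu, hx, hy⟩
    refine ⟨hu, (hS _).2 ⟨?_, ?_⟩⟩
    · simpa using hx
    · have e : σ + τ * (a i + u • (b i - a i)) k' =
          σ + τ * a i k' + u * (τ * (b i - a i) k') := by
        simp; ring
      rw [e]
      exact hy
  refine (ENNReal.ofReal_le_ofReal hmain).trans ?_
  rw [ENNReal.ofReal_tsum_of_nonneg (fun i => by
    split_ifs
    · exact mul_nonneg (abs_nonneg _) measureReal_nonneg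
    · exact le_rfl) hs]
  have hsub := tsum_subtype {j | Pr j} (fun i => μH[1] (segment ℝ (a i) (b i) ∩ S))
  refine le_trans ?_ (le_of_eq hsub.symm)
  refine ENNReal.tsum_le_tsum fun i => ?_
  by_cases hp : Pr i
  · rw [if_pos hp, indicator_of_mem (show i ∈ {j | Pr j} from hp)]
    exact hTi i
  · rw [if_neg hp]
    simp

/-- Lemma 10: for a segment barrier of the unit square of total length at
most 2 + δ (δ = 10⁻¹², sin φ = 10⁻⁴, w₁ = 1/20, w₂ = 1/1000), the almost horizontal
segments X have total length at least 0.45 in each of the thin horizontal rectangles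
U_low = [0,1] × [−w₂, w₁] and U_high = [0,1] × [1 − w₁, 1 + w₂], and the almost vertical
segments Y have total length at least 0.45 in each of the thin vertical rectangles
U_left = [−w₂, w₁] × [0,1] and U_right = [1 − w₁, 1 + w₂] × [0,1]. -/
theorem weight_in_thin_rectangles
    (a b : ℕ → Pt) (hab : ∀ i, a i ≠ b i)
    (hbar : IsBarrier (⋃ i, segment ℝ (a i) (b i)) unitSquare)
    (hsum : Summable fun i => ‖b i - a i‖)
    (hL : ∑' i, ‖b i - a i‖ ≤ 2 + 10 ^ (-12 : ℤ)) :
    (ENNReal.ofReal 0.45 ≤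
      ∑' i : {j : ℕ // AlmostHorizontal (a j) (b j)},
        μH[1] (segment ℝ (a i.1) (b i.1) ∩
          {p : Pt | p 0 ∈ Icc (0:ℝ) 1 ∧ p 1 ∈ Icc (-(1/1000) : ℝ) (1/20)})) ∧
    (ENNReal.ofReal 0.45 ≤
      ∑' i : {j : ℕ // AlmostHorizontal (a j) (b j)},
        μH[1] (segment ℝ (a i.1) (b i.1) ∩
          {p : Pt | p 0 ∈ Icc (0:ℝ) 1 ∧ p 1 ∈ Icc (1 - 1/20 : ℝ) (1 + 1/1000)})) ∧
    (ENNReal.ofReal 0.45 ≤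
      ∑' i : {j : ℕ // AlmostVertical (a j) (b j)},
        μH[1] (segment ℝ (a i.1) (b i.1) ∩
          {p : Pt | p 0 ∈ Icc (-(1/1000) : ℝ) (1/20) ∧ p 1 ∈ Icc (0:ℝ) 1})) ∧
    (ENNReal.ofReal 0.45 ≤
      ∑' i : {j : ℕ // AlmostVertical (a j) (b j)},
        μH[1] (segment ℝ (a i.1) (b i.1) ∩
          {p : Pt | p 0 ∈ Icc (1 - 1/20 : ℝ) (1 + 1/1000) ∧ p 1 ∈ Icc (0:ℝ) 1})) := by
  refine ⟨?_, ?_, ?_, ?_⟩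
  · exact wtr_final a b hbar hsum hL 0 1 (by simp) 0 1 (by simp) _
      (fun p => by simp) _ (fun i => Iff.rfl)
  · refine wtr_final a b hbar hsum hL 0 1 (by simp) 1 (-1) (by simp) _
      (fun p => ?_) _ (fun i => Iff.rfl)
    simp only [mem_setOf_eq, mem_Icc]
    constructor
    · rintro ⟨h1, h2, h3⟩
      exact ⟨h1, by linarith, by linarith⟩
    · rintro ⟨h1, h2, h3⟩
      exact ⟨h1, by linarith, by linarith⟩
  · refine wtr_final a b hbar hsum hL 1 0 (by simp) 0 1 (by simp) _
      (fun p => ?_) _ (fun i => Iff.rfl)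
    simp only [mem_setOf_eq, zero_add, one_mul]
    exact and_comm
  · refine wtr_final a b hbar hsum hL 1 0 (by simp) 1 (-1) (by simp) _
      (fun p => ?_) _ (fun i => Iff.rfl)
    simp only [mem_setOf_eq, mem_Icc]
    constructor
    · rintro ⟨⟨h2, h3⟩, h1⟩
      exact ⟨h1, by linarith, by linarith⟩
    · rintro ⟨h1, h2, h3⟩
      exact ⟨⟨by linarith, by linarith⟩, h1⟩
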